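/- Let μ, κ, γ, M₀, T₀ > 0, let (P,γ) be an admissible pair with pressure potential W, and let (ρ,u,c) be a smooth periodic solution of the non-local Navier–Stokes–Korteweg system on [0,T₀) with initial data (ρ₀,u₀) satisfying M₀⁻¹ ≤ ρ₀(x) ≤ M₀ for all x. Then there exists a constant C(T₀) > 0, depending only on ‖ρ₀‖_{H¹(𝕋)}, ‖u₀‖_{H¹(𝕋)}, M₀, μ, κ, γ, W and T₀, such that C(T₀)⁻¹ ≤ ρ(t,x) ≤ C(T₀) for all (t,x) ∈ [0,T₀) × ℝ. -/

import Mathlib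

open MeasureTheory Filter Set

/-- The `L²` norm of a `1`-periodic function, computed over one period. -/
noncomputable def L2norm (f : ℝ → ℝ) : ℝ := Real.sqrt (∫ x in (0:ℝ)..1, f x ^ 2)

/-- The `H¹` norm of a `1`-periodic function, computed over one period. -/
noncomputable def H1norm (f : ℝ → ℝ) : ℝ :=
  Real.sqrt (∫ x in (0:ℝ)..1, f x ^ 2 + deriv f x ^ 2)

/-- The `H²` norm of a `1`-periodic function, computed over one period. -/
noncomputable def H2norm (f : ℝ → ℝ) : ℝ :=
  Real.sqrt (∫ x in (0:ℝ)..1, f x ^ 2 + deriv f x ^ 2 + deriv (deriv f) x ^ 2)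

/-- The sup-norm of a `1`-periodic function, computed over one period. -/
noncomputable def LinfNorm (f : ℝ → ℝ) : ℝ := sSup ((fun x => |f x|) '' Set.Icc (0:ℝ) 1)

/-- The `W^{1,∞}` norm of a `1`-periodic function. -/
noncomputable def W1infNorm (f : ℝ → ℝ) : ℝ := LinfNorm f + LinfNorm (deriv f)

/-- The artificial pressure `P_γ(r) = P(r) + (γ/2) r²`. -/
noncomputable def artificialPressure (P : ℝ → ℝ) (γ : ℝ) (r : ℝ) : ℝ := P r + γ / 2 * r ^ 2

/-- A pair `(P, γ)` is admissible (with exponent `β` and limit `a`). -/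
structure IsAdmissiblePair (P : ℝ → ℝ) (γ β a : ℝ) : Prop where
  gamma_pos : 0 < γ
  beta_ge : 2 ≤ β
  a_pos : 0 < a
  nonneg : ∀ r, 0 ≤ r → 0 ≤ P r
  smooth : ContDiffOn ℝ 1 P (Set.Ici 0)
  zero : P 0 = 0
  lim : Filter.Tendsto (fun r => deriv P r / r ^ (β - 1)) Filter.atTop (nhds a)
  mono : MonotoneOn (artificialPressure P γ) (Set.Ici 0)

/-- `W` is a pressure potential for `P`: `W : [0,∞) → [0,∞)`, twice continuously
differentiable on `(0,∞)`, with `W''(r)·r = P'(r)` for `r > 0`. -/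
structure IsPressurePotential (P W : ℝ → ℝ) : Prop where
  nonneg : ∀ r, 0 ≤ r → 0 ≤ W r
  smooth : ContDiffOn ℝ 2 W (Set.Ioi 0)
  relation : ∀ r : ℝ, 0 < r → deriv (deriv W) r * r = deriv P r

/-- A smooth `1`-periodic-in-space solution of the non-local Navier–Stokes–Korteweg
system on the time set `S`, with initial data `(ρ₀, u₀)`. -/
structure IsNSKSolution (μ κ γ : ℝ) (P : ℝ → ℝ) (S : Set ℝ)
    (ρ u c : ℝ → ℝ → ℝ) (ρ₀ u₀ : ℝ → ℝ) : Prop where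
  smooth_rho : ContDiffOn ℝ (⊤ : ℕ∞) (fun p : ℝ × ℝ => ρ p.1 p.2) (S ×ˢ (Set.univ : Set ℝ))
  smooth_u : ContDiffOn ℝ (⊤ : ℕ∞) (fun p : ℝ × ℝ => u p.1 p.2) (S ×ˢ (Set.univ : Set ℝ))
  smooth_c : ContDiffOn ℝ (⊤ : ℕ∞) (fun p : ℝ × ℝ => c p.1 p.2) (S ×ˢ (Set.univ : Set ℝ))
  periodic_rho : ∀ t x, ρ t (x + 1) = ρ t x
  periodic_u : ∀ t x, u t (x + 1) = u t x
  periodic_c : ∀ t x, c t (x + 1) = c t x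
  rho_pos : ∀ t x, 0 < ρ t x
  mass : ∀ t ∈ S, ∀ x : ℝ,
    deriv (fun s => ρ s x) t + deriv (fun y => ρ t y * u t y) x = 0
  momentum : ∀ t ∈ S, ∀ x : ℝ,
    deriv (fun s => ρ s x * u s x) t
      + deriv (fun y => ρ t y * u t y ^ 2) x
      + deriv (fun y => P (ρ t y)) x
      - μ * deriv (deriv (u t)) x
      - γ * ρ t x * deriv (fun y => c t y - ρ t y) x = 0
  elliptic : ∀ t ∈ S, ∀ x : ℝ,
    -κ * deriv (deriv (c t)) x + γ * (c t x - ρ t x) = 0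
  init_rho : ∀ x, ρ 0 x = ρ₀ x
  init_u : ∀ x, u 0 x = u₀ x

open scoped ContDiff Topology

theorem slice_contDiff {n : WithTop ℕ∞} {S : Set ℝ} {F : ℝ → ℝ → ℝ}
    (hF : ContDiffOn ℝ n (fun p : ℝ × ℝ => F p.1 p.2) (S ×ˢ (univ : Set ℝ)))
    {t : ℝ} (ht : t ∈ S) : ContDiff ℝ n (F t) := by
  rw [← contDiffOn_univ]
  exact hF.comp (g := fun p : ℝ × ℝ => F p.1 p.2) (f := fun x : ℝ => (t, x))
    (contDiff_const.prodMk contDiff_id).contDiffOn (fun x _ => ⟨ht, mem_univ x⟩)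

theorem uniqueDiffOn_Ico_prod_univ {T : ℝ} :
    UniqueDiffOn ℝ (Ico 0 T ×ˢ (univ : Set ℝ)) :=
  (uniqueDiffOn_Ico 0 T).prod uniqueDiffOn_univ

theorem deriv_snd_eq_fderivWithin {S : Set ℝ} {F : ℝ → ℝ → ℝ} {t x : ℝ}
    (hF : DifferentiableOn ℝ (fun p : ℝ × ℝ => F p.1 p.2) (S ×ˢ (univ : Set ℝ)))
    (ht : t ∈ S) :
    deriv (F t) x
      = fderivWithin ℝ (fun p : ℝ × ℝ => F p.1 p.2) (S ×ˢ (univ : Set ℝ)) (t, x) (0, 1) := by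
  have h1 := (hF (t, x) ⟨ht, mem_univ x⟩).hasFDerivWithinAt
  have h2 : HasDerivWithinAt (fun y : ℝ => (t, y)) ((0 : ℝ), (1 : ℝ)) univ x :=
    ((hasDerivAt_const x t).prodMk (hasDerivAt_id x)).hasDerivWithinAt
  have h3 := h1.comp_hasDerivWithinAt x h2 (fun y _ => ⟨ht, mem_univ y⟩)
  exact (hasDerivWithinAt_univ.1 h3).deriv

theorem contDiffOn_deriv_snd {T : ℝ} {F : ℝ → ℝ → ℝ}
    (hF : ContDiffOn ℝ ∞ (fun p : ℝ × ℝ => F p.1 p.2) (Ico 0 T ×ˢ (univ : Set ℝ))) :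
    ContDiffOn ℝ ∞ (fun p : ℝ × ℝ => deriv (F p.1) p.2) (Ico 0 T ×ˢ (univ : Set ℝ)) := by
  have h := hF.fderivWithin (m := ∞) uniqueDiffOn_Ico_prod_univ (by simp)
  have h2 := h.clm_apply (contDiffOn_const (c := ((0 : ℝ), (1 : ℝ))))
  refine h2.congr fun p hp => ?_
  exact deriv_snd_eq_fderivWithin (hF.differentiableOn (by simp)) hp.1

theorem isOpen_strip {T : ℝ} : IsOpen (Ioo 0 T ×ˢ (univ : Set ℝ)) := isOpen_Ioo.prod isOpen_univ

theorem hasDerivAt_fst {F : ℝ × ℝ → ℝ} {t x : ℝ} (hF : DifferentiableAt ℝ F (t, x)) :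
    HasDerivAt (fun s => F (s, x)) (fderiv ℝ F (t, x) (1, 0)) t :=
  hF.hasFDerivAt.comp_hasDerivAt t ((hasDerivAt_id t).prodMk (hasDerivAt_const t x))

theorem hasDerivAt_snd {F : ℝ × ℝ → ℝ} {t x : ℝ} (hF : DifferentiableAt ℝ F (t, x)) :
    HasDerivAt (fun y => F (t, y)) (fderiv ℝ F (t, x) (0, 1)) x :=
  hF.hasFDerivAt.comp_hasDerivAt x ((hasDerivAt_const x t).prodMk (hasDerivAt_id x))

/-- Mixed partial derivatives of a smooth function commute. -/
theorem hasDerivAt_deriv_snd {T : ℝ} {F : ℝ → ℝ → ℝ}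
    (hF : ContDiffOn ℝ ∞ (fun p : ℝ × ℝ => F p.1 p.2) (Ioo 0 T ×ˢ (univ : Set ℝ)))
    {t : ℝ} (ht : t ∈ Ioo 0 T) (x : ℝ) :
    HasDerivAt (fun s => deriv (F s) x) (deriv (fun y => deriv (fun s => F s y) t) x) t := by
  set G : ℝ × ℝ → ℝ := fun p => F p.1 p.2 with hG
  have hat : ∀ s ∈ Ioo 0 T, ∀ y, ContDiffAt ℝ ∞ G (s, y) := fun s hs y =>
    hF.contDiffAt (isOpen_strip.mem_nhds ⟨hs, mem_univ y⟩)
  have hd : ∀ s ∈ Ioo 0 T, ∀ y, DifferentiableAt ℝ G (s, y) := fun s hs y =>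
    (hat s hs y).differentiableAt (by simp)
  have hdd : DifferentiableAt ℝ (fderiv ℝ G) (t, x) :=
    ((hat t ht x).fderiv_right (m := ∞) (by simp)).differentiableAt (by simp)
  have hsymm : IsSymmSndFDerivAt ℝ G (t, x) := (hat t ht x).isSymmSndFDerivAt (by
    rw [minSmoothness_of_isRCLikeNormedField]; exact WithTop.coe_le_coe.2 le_top)
  have hx : (fun y => deriv (fun s => F s y) t) = fun y => fderiv ℝ G (t, y) (1, 0) := by
    funext y
    exact (hasDerivAt_fst (hd t ht y)).deriv
  have h1 : HasDerivAt (fun s => fderiv ℝ G (s, x) (0, 1))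
      (fderiv ℝ (fderiv ℝ G) (t, x) (1, 0) (0, 1)) t := by
    have := hdd.hasFDerivAt.comp_hasDerivAt t ((hasDerivAt_id t).prodMk (hasDerivAt_const t x))
    simpa using this.clm_apply (hasDerivAt_const t ((0 : ℝ), (1 : ℝ)))
  have h2 : HasDerivAt (fun y => fderiv ℝ G (t, y) (1, 0))
      (fderiv ℝ (fderiv ℝ G) (t, x) (0, 1) (1, 0)) x := by
    have := hdd.hasFDerivAt.comp_hasDerivAt x ((hasDerivAt_const x t).prodMk (hasDerivAt_id x))
    simpa using this.clm_apply (hasDerivAt_const x ((1 : ℝ), (0 : ℝ)))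
  rw [hx, h2.deriv, hsymm.eq (0, 1) (1, 0)]
  refine h1.congr_of_eventuallyEq ?_
  filter_upwards [isOpen_Ioo.mem_nhds ht] with s hs
  exact (hasDerivAt_snd (hd s hs x)).deriv

/-- Differentiation under the integral sign for functions which are `C¹` on a strip. -/
theorem hasDerivAt_integral_of_contDiffOn {T : ℝ} {e : ℝ → ℝ → ℝ}
    (he : ContDiffOn ℝ 1 (fun p : ℝ × ℝ => e p.1 p.2) (Ioo 0 T ×ˢ (univ : Set ℝ)))
    {t : ℝ} (ht : t ∈ Ioo 0 T) :
    Continuous (fun x => deriv (fun s => e s x) t) ∧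
    HasDerivAt (fun s => ∫ x in (0:ℝ)..1, e s x)
      (∫ x in (0:ℝ)..1, deriv (fun s => e s x) t) t := by
  set G : ℝ × ℝ → ℝ := fun p => e p.1 p.2 with hG
  have hd : ∀ s ∈ Ioo 0 T, ∀ y, DifferentiableAt ℝ G (s, y) := fun s hs y =>
    (he.contDiffAt (isOpen_strip.mem_nhds ⟨hs, mem_univ y⟩)).differentiableAt (by simp)
  have hder : ∀ s ∈ Ioo 0 T, ∀ y,
      HasDerivAt (fun s => e s y) (fderiv ℝ G (s, y) (1, 0)) s := fun s hs y =>
    hasDerivAt_fst (hd s hs y)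
  have hcont : ContinuousOn (fun p : ℝ × ℝ => fderiv ℝ G p (1, 0)) (Ioo 0 T ×ˢ (univ : Set ℝ)) :=
    (he.continuousOn_fderiv_of_isOpen isOpen_strip le_rfl).clm_apply continuousOn_const
  have hslice : ∀ s ∈ Ioo 0 T, Continuous (fun y => fderiv ℝ G (s, y) (1, 0)) := fun s hs => by
    rw [← continuousOn_univ]
    exact hcont.comp (f := fun y : ℝ => (s, y)) (by fun_prop) (fun y _ => ⟨hs, mem_univ y⟩)
  have heq : (fun x => deriv (fun s => e s x) t) = fun x => fderiv ℝ G (t, x) (1, 0) := by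
    funext x
    exact (hder t ht x).deriv
  rw [heq]
  refine ⟨hslice t ht, ?_⟩
  obtain ⟨ε, hε, hball⟩ := Metric.isOpen_iff.1 (isOpen_Ioo (a := (0:ℝ)) (b := T)) t ht
  have hsub : Icc (t - ε / 2) (t + ε / 2) ⊆ Ioo 0 T := fun s hs => hball (by
    rw [Metric.mem_ball, Real.dist_eq, abs_lt]
    constructor <;> linarith [hs.1, hs.2])
  have hcpt : IsCompact (Icc (t - ε / 2) (t + ε / 2) ×ˢ Icc (0:ℝ) 1) :=
    isCompact_Icc.prod isCompact_Icc
  obtain ⟨B, hB⟩ := hcpt.exists_bound_of_continuousOn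
    (hcont.mono (prod_mono hsub (subset_univ _)))
  have hnhds : Icc (t - ε / 2) (t + ε / 2) ∈ 𝓝 t := Icc_mem_nhds (by linarith) (by linarith)
  refine (intervalIntegral.hasDerivAt_integral_of_dominated_loc_of_deriv_le
    (F' := fun s x => fderiv ℝ G (s, x) (1, 0)) (bound := fun _ => B) hnhds ?_ ?_ ?_ ?_ ?_ ?_).2
  · filter_upwards [hnhds] with s hs
    exact (slice_contDiff he (hsub hs)).continuous.aestronglyMeasurable
  · exact (slice_contDiff he ht).continuous.intervalIntegrable _ _
  · exact (hslice t ht).aestronglyMeasurable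
  · refine Eventually.of_forall fun x hx s hs => hB (s, x) ⟨hs, ?_⟩
    rw [uIoc_of_le zero_le_one] at hx
    exact ⟨hx.1.le, hx.2⟩
  · exact intervalIntegrable_const
  · exact Eventually.of_forall fun x _ s hs => hder s (hsub hs) x

theorem continuousOn_integral_strip {T t : ℝ} {e : ℝ → ℝ → ℝ}
    (he : ContinuousOn (fun p : ℝ × ℝ => e p.1 p.2) (Ico 0 T ×ˢ (univ : Set ℝ)))
    (ht : t ∈ Ico 0 T) : ContinuousOn (fun s => ∫ x in (0:ℝ)..1, e s x) (Icc 0 t) := by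
  have hc : Continuous (Function.uncurry fun s x => e (projIcc 0 t ht.1 s) x) := by
    rw [← continuousOn_univ]
    refine he.comp (f := fun p : ℝ × ℝ => ((projIcc 0 t ht.1 p.1 : ℝ), p.2)) ?_ ?_
    · exact (by fun_prop : Continuous _).continuousOn
    · intro p _
      have := (projIcc 0 t ht.1 p.1).2
      exact ⟨⟨this.1, this.2.trans_lt ht.2⟩, mem_univ _⟩
  have := intervalIntegral.continuous_parametric_intervalIntegral_of_continuous' (μ := volume)
    hc 0 1
  refine this.continuousOn.congr fun s hs => ?_
  simp only [projIcc_of_mem ht.1 hs]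

/-- Gronwall estimate for a density `e` with periodic flux `q`:
if `∂ₜ e + ∂ₓ q ≤ k e` then `∫ e` grows at most like `exp (k t)`. -/
theorem integral_le_exp_mul_of_flux {T k : ℝ} {e q : ℝ → ℝ → ℝ}
    (hc : ContinuousOn (fun p : ℝ × ℝ => e p.1 p.2) (Ico 0 T ×ˢ (univ : Set ℝ)))
    (he : ContDiffOn ℝ 1 (fun p : ℝ × ℝ => e p.1 p.2) (Ioo 0 T ×ˢ (univ : Set ℝ)))
    (hq : ∀ t ∈ Ioo 0 T, ContDiff ℝ 1 (q t))
    (hper : ∀ t, q t 1 = q t 0)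
    (hle : ∀ t ∈ Ioo 0 T, ∀ x, deriv (fun s => e s x) t + deriv (q t) x ≤ k * e t x)
    {t : ℝ} (ht : t ∈ Ico 0 T) :
    ∫ x in (0:ℝ)..1, e t x ≤ Real.exp (k * t) * ∫ x in (0:ℝ)..1, e 0 x := by
  set I : ℝ → ℝ := fun s => ∫ x in (0:ℝ)..1, e s x with hI
  have hcont : ContinuousOn (fun s => Real.exp (-k * s) * I s) (Icc 0 t) :=
    (by fun_prop : Continuous fun s : ℝ => Real.exp (-k * s)).continuousOn.mul
      (continuousOn_integral_strip hc ht)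
  have hder : ∀ s ∈ Ioo 0 T, ∃ d, HasDerivAt I d s ∧ d ≤ k * I s := by
    intro s hs
    obtain ⟨h1, h2⟩ := hasDerivAt_integral_of_contDiffOn he hs
    refine ⟨_, h2, ?_⟩
    have hqc : Continuous (deriv (q s)) := (hq s hs).continuous_deriv le_rfl
    have hq0 : ∫ x in (0:ℝ)..1, deriv (q s) x = 0 := by
      rw [intervalIntegral.integral_deriv_eq_sub
        (fun x _ => ((hq s hs).differentiable (by simp)) x) (hqc.intervalIntegrable _ _), hper,
        sub_self]
    have hec : Continuous (e s) := (slice_contDiff he hs).continuous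
    calc ∫ x in (0:ℝ)..1, deriv (fun r => e r x) s
        = ∫ x in (0:ℝ)..1, (deriv (fun r => e r x) s + deriv (q s) x) := by
          rw [intervalIntegral.integral_add (h1.intervalIntegrable _ _)
            (hqc.intervalIntegrable _ _), hq0, add_zero]
      _ ≤ ∫ x in (0:ℝ)..1, k * e s x :=
          intervalIntegral.integral_mono_on zero_le_one
            ((h1.add hqc).intervalIntegrable _ _)
            ((hec.const_mul k).intervalIntegrable _ _) (fun x _ => hle s hs x)
      _ = k * I s := intervalIntegral.integral_const_mul _ _
  have hanti : AntitoneOn (fun s => Real.exp (-k * s) * I s) (Icc 0 t) := by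
    refine antitoneOn_of_deriv_nonpos (convex_Icc 0 t) hcont ?_ ?_
    · intro s hs
      rw [interior_Icc] at hs
      obtain ⟨d, hd, -⟩ := hder s ⟨hs.1, hs.2.trans ht.2⟩
      exact (((hasDerivAt_id s).const_mul (-k)).exp.mul hd).differentiableAt.differentiableWithinAt
    · intro s hs
      rw [interior_Icc] at hs
      obtain ⟨d, hd, hdle⟩ := hder s ⟨hs.1, hs.2.trans ht.2⟩
      have h := ((hasDerivAt_id s).const_mul (-k)).exp.mul hd
      have h' : deriv (fun s => Real.exp (-k * s) * I s) s
          = Real.exp (-k * s) * (d - k * I s) := by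
        refine (h.deriv).trans ?_
        simp only [id]
        ring
      rw [h']
      exact mul_nonpos_of_nonneg_of_nonpos (Real.exp_pos _).le (by linarith)
  have h := hanti (left_mem_Icc.2 ht.1) (right_mem_Icc.2 ht.1) ht.1
  simp only [mul_zero, Real.exp_zero, one_mul] at h
  calc I t = Real.exp (k * t) * (Real.exp (-k * t) * I t) := by
        rw [← mul_assoc, ← Real.exp_add]; simp
    _ ≤ Real.exp (k * t) * I 0 := mul_le_mul_of_nonneg_left h (Real.exp_pos _).le

theorem deriv_deriv_nonneg_of_isMin {f : ℝ → ℝ} {x₀ : ℝ} (hf : Continuous f)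
    (hmin : ∀ x, f x₀ ≤ f x) : 0 ≤ deriv (deriv f) x₀ := by
  by_contra! hneg
  have hd : deriv f x₀ = 0 := IsLocalMin.deriv_eq_zero (Eventually.of_forall hmin)
  have hmax : IsLocalMax f x₀ := isLocalMax_of_deriv_deriv_neg hneg hd hf.continuousAt
  have hconst : f =ᶠ[𝓝 x₀] fun _ => f x₀ := by
    filter_upwards [hmax] with x hx
    exact le_antisymm hx (hmin x)
  have h0 := hconst.deriv.deriv_eq
  simp at h0
  exact hneg.ne h0

theorem exists_forall_le_of_periodic {f : ℝ → ℝ} (hf : Continuous f)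
    (hper : Function.Periodic f 1) : ∃ x₀, ∀ x, f x₀ ≤ f x := by
  obtain ⟨x₀, -, hx₀⟩ := isCompact_Icc.exists_isMinOn (nonempty_Icc.2 (zero_le_one' ℝ))
    hf.continuousOn
  refine ⟨x₀, fun x => ?_⟩
  obtain ⟨y, hy, hxy⟩ := hper.exists_mem_Ico₀ one_pos x
  rw [hxy]
  exact hx₀ (Ico_subset_Icc_self hy)

/-- Gradient bound for periodic solutions of the screened Poisson equation with positive
right-hand side. -/
theorem abs_deriv_le_of_screened_poisson {κ γ : ℝ} (hκ : 0 < κ) (hγ : 0 < γ) {c r : ℝ → ℝ}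
    (hc : ContDiff ℝ 2 c) (hr : Continuous r) (hcper : Function.Periodic c 1)
    (hrper : Function.Periodic r 1) (hrpos : ∀ x, 0 < r x)
    (heq : ∀ x, -κ * deriv (deriv c) x + γ * (c x - r x) = 0) (x : ℝ) :
    |deriv c x| ≤ γ / κ * ∫ y in (0:ℝ)..1, r y := by
  have hdd : ∀ x, deriv (deriv c) x = γ / κ * (c x - r x) := fun x => by
    field_simp
    linarith [heq x]
  have hcc : Continuous c := hc.continuous
  have hc1 : ContDiff ℝ 1 (deriv c) :=
    (contDiff_succ_iff_deriv.1 (show ContDiff ℝ (1 + 1) c from hc)).2.2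
  have hdper : Function.Periodic (deriv c) 1 := fun x => by
    rw [← deriv_comp_add_const, show (fun y => c (y + 1)) = c from funext hcper]
  obtain ⟨x₀, hx₀⟩ := exists_forall_le_of_periodic hcc hcper
  have hcpos : ∀ x, 0 < c x := fun x => by
    have h1 := deriv_deriv_nonneg_of_isMin hcc hx₀
    rw [hdd] at h1
    have h2 : 0 ≤ c x₀ - r x₀ := nonneg_of_mul_nonneg_right h1 (by positivity)
    linarith [hrpos x₀, hx₀ x]
  have hd0 : deriv c x₀ = 0 := IsLocalMin.deriv_eq_zero (Eventually.of_forall hx₀)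
  have hint : ∀ a b, deriv c b - deriv c a
      = γ / κ * ((∫ y in a..b, c y) - ∫ y in a..b, r y) := fun a b => by
    rw [← intervalIntegral.integral_deriv_eq_sub
      (fun x _ => (hc1.differentiable (by simp)) x)
      ((hc1.continuous_deriv le_rfl).intervalIntegrable _ _),
      ← intervalIntegral.integral_sub (hcc.intervalIntegrable _ _) (hr.intervalIntegrable _ _),
      ← intervalIntegral.integral_const_mul]
    simp only [hdd]
  have hmass : (∫ y in (0:ℝ)..1, c y) = ∫ y in (0:ℝ)..1, r y := by
    have h := hint 0 1
    have h01 : deriv c 1 = deriv c 0 := by simpa using hdper 0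
    rw [h01, sub_self] at h
    have := (mul_eq_zero.1 h.symm).resolve_left (by positivity)
    linarith
  obtain ⟨z, hz, hxz⟩ := hdper.exists_mem_Ico one_pos x x₀
  rw [hxz]
  have hle : ∀ f : ℝ → ℝ, Continuous f → Function.Periodic f 1 → (∀ x, 0 < f x) →
      0 ≤ (∫ y in x₀..z, f y) ∧ (∫ y in x₀..z, f y) ≤ ∫ y in (0:ℝ)..1, f y := by
    intro f hf hp hpos
    refine ⟨intervalIntegral.integral_nonneg hz.1 fun y _ => (hpos y).le, ?_⟩
    have h1 : (∫ y in (0:ℝ)..1, f y) = ∫ y in x₀..x₀ + 1, f y := by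
      simpa using hp.intervalIntegral_add_eq 0 x₀
    rw [h1]
    exact intervalIntegral.integral_mono_interval le_rfl hz.1 hz.2.le
      (Eventually.of_forall fun y => (hpos y).le) (hf.intervalIntegrable _ _)
  obtain ⟨h1, h2⟩ := hle c hcc hcper hcpos
  obtain ⟨h3, h4⟩ := hle r hr hrper hrpos
  have h := hint x₀ z
  rw [hd0, sub_zero] at h
  rw [h, abs_mul, abs_of_pos (by positivity : 0 < γ / κ)]
  gcongr
  rw [abs_le]
  constructor <;> linarith

/-- A positive function whose logarithmic derivative has integral at most `L` is comparable to
its mean, with constant `exp L`. -/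
theorem mean_bounds_of_integral_logDeriv {r : ℝ → ℝ} (hr : ContDiff ℝ 1 r)
    (hpos : ∀ x, 0 < r x) {L : ℝ} (hL : ∫ x in (0:ℝ)..1, |deriv r x / r x| ≤ L)
    {x : ℝ} (hx : x ∈ Icc (0:ℝ) 1) :
    (∫ y in (0:ℝ)..1, r y) ≤ Real.exp L * r x ∧ r x ≤ Real.exp L * ∫ y in (0:ℝ)..1, r y := by
  have hcont : Continuous fun x => deriv r x / r x :=
    (hr.continuous_deriv le_rfl).div hr.continuous fun x => (hpos x).ne'
  have key : ∀ a ∈ Icc (0:ℝ) 1, ∀ b ∈ Icc (0:ℝ) 1, r b ≤ Real.exp L * r a := by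
    intro a ha b hb
    have h1 : ∫ y in a..b, deriv r y / r y = Real.log (r b) - Real.log (r a) :=
      intervalIntegral.integral_eq_sub_of_hasDerivAt
        (fun y _ => ((hr.differentiable (by simp)) y).hasDerivAt.log (hpos y).ne')
        (hcont.intervalIntegrable _ _)
    have hsub : uIoc a b ⊆ uIoc 0 1 := uIoc_subset_uIoc_of_uIcc_subset_uIcc
      (uIcc_subset_uIcc (by rwa [uIcc_of_le zero_le_one]) (by rwa [uIcc_of_le zero_le_one]))
    have h2 : |∫ y in a..b, deriv r y / r y| ≤ L := calc
      |∫ y in a..b, deriv r y / r y| ≤ |(∫ y in a..b, |deriv r y / r y|)| :=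
        intervalIntegral.norm_integral_le_abs_integral_norm (f := fun y => deriv r y / r y)
      _ ≤ |(∫ y in (0:ℝ)..1, |deriv r y / r y|)| :=
        intervalIntegral.abs_integral_mono_interval hsub
          (Eventually.of_forall fun y => abs_nonneg _) (hcont.abs.intervalIntegrable _ _)
      _ = ∫ y in (0:ℝ)..1, |deriv r y / r y| :=
        abs_of_nonneg (intervalIntegral.integral_nonneg zero_le_one fun y _ => abs_nonneg _)
      _ ≤ L := hL
    have h3 : Real.log (r b) ≤ L + Real.log (r a) := by
      rw [h1] at h2
      linarith [le_abs_self (Real.log (r b) - Real.log (r a))]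
    rw [← Real.exp_log (hpos b)]
    calc Real.exp (Real.log (r b)) ≤ Real.exp (L + Real.log (r a)) := Real.exp_le_exp.2 h3
      _ = Real.exp L * r a := by rw [Real.exp_add, Real.exp_log (hpos a)]
  have hint : IntervalIntegrable r volume 0 1 := hr.continuous.intervalIntegrable _ _
  constructor
  · have := intervalIntegral.integral_mono_on zero_le_one hint
      (intervalIntegrable_const (c := Real.exp L * r x)) (fun y hy => key x hx y hy)
    simpa using this
  · have := intervalIntegral.integral_mono_on zero_le_one
      (intervalIntegrable_const (c := r x)) (hint.const_mul (Real.exp L))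
      (fun y hy => key y hy x hx)
    simpa using this

/-- The effective (Bresch–Desjardins) velocity `u + μ ρₓ / ρ²`. -/
noncomputable def effectiveVelocity (μ : ℝ) (ρ u : ℝ → ℝ → ℝ) (t x : ℝ) : ℝ :=
  u t x + μ * deriv (ρ t) x / ρ t x ^ 2

/-- The sum of the kinetic energies of the physical and of the effective velocity and of twice the
potential energy of the artificial pressure, plus a multiple `K²` of the mass density. -/
noncomputable def bdEnergy (μ γ K : ℝ) (W : ℝ → ℝ) (ρ u : ℝ → ℝ → ℝ) (t x : ℝ) : ℝ :=
  1 / 2 * (ρ t x * u t x ^ 2) + 1 / 2 * (ρ t x * effectiveVelocity μ ρ u t x ^ 2)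
    + 2 * W (ρ t x) + γ * ρ t x ^ 2 + K ^ 2 * ρ t x

/-- The flux belonging to `bdEnergy`. -/
noncomputable def bdFlux (μ γ K : ℝ) (W : ℝ → ℝ) (ρ u : ℝ → ℝ → ℝ) (t x : ℝ) : ℝ :=
  1 / 2 * (ρ t x * u t x * u t x ^ 2)
    + 1 / 2 * (ρ t x * u t x * effectiveVelocity μ ρ u t x ^ 2)
    + (2 * deriv W (ρ t x) + 2 * γ * ρ t x + K ^ 2) * (ρ t x * u t x)
    - μ * (u t x * deriv (u t) x)

theorem IsAdmissiblePair.deriv_nonneg {P : ℝ → ℝ} {γ β a : ℝ} (h : IsAdmissiblePair P γ β a)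
    {r : ℝ} (hr : 0 < r) : DifferentiableAt ℝ P r ∧ 0 ≤ deriv P r + γ * r := by
  have hd : DifferentiableAt ℝ P r :=
    (h.smooth.contDiffAt (Ici_mem_nhds hr)).differentiableAt (by simp)
  refine ⟨hd, ?_⟩
  have h1 : HasDerivAt (artificialPressure P γ) (deriv P r + γ * r) r := by
    refine (hd.hasDerivAt.add ((hasDerivAt_pow 2 r).const_mul (γ / 2))).congr_deriv ?_
    norm_num
    ring
  have h2 := h.mono.derivWithin_nonneg (x := r)
  rwa [derivWithin_of_mem_nhds (Ici_mem_nhds hr), h1.deriv] at h2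

theorem bdEnergy_algebra {μ γ K r rt rx rxx u ut ux uxx v vt vx cx p w w1 w2 : ℝ}
    (hμ : 0 < μ) (hr : 0 < r) (hw : 0 ≤ w) (hγ : 0 < γ) (hp : 0 ≤ p + γ * r)
    (hK : |γ * cx| ≤ K) (hw2 : w2 * r = p)
    (hv : v = u + μ * rx / r ^ 2)
    (hvt : vt = ut + μ * (-(rxx * u + 2 * (rx * ux) + r * uxx) / r ^ 2 - 2 * rx * rt / r ^ 3))
    (hvx : vx = ux + μ * (rxx / r ^ 2 - 2 * rx * rx / r ^ 3))
    (hmass : rt + (rx * u + r * ux) = 0)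
    (hmom : rt * u + r * ut + (rx * u ^ 2 + r * (2 * u * ux)) + p * rx - μ * uxx
      - γ * r * (cx - rx) = 0) :
    (1 / 2 * (rt * u ^ 2 + r * (2 * u * ut)) + 1 / 2 * (rt * v ^ 2 + r * (2 * v * vt))
        + 2 * (w1 * rt) + γ * (2 * r * rt) + K ^ 2 * rt)
      + (1 / 2 * ((rx * u + r * ux) * u ^ 2 + r * u * (2 * u * ux))
        + 1 / 2 * ((rx * u + r * ux) * v ^ 2 + r * u * (2 * v * vx))
        + ((2 * (w2 * rx) + 2 * γ * rx) * (r * u)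
          + (2 * w1 + 2 * γ * r + K ^ 2) * (rx * u + r * ux))
        - μ * (ux * ux + u * uxx))
      ≤ 1 / 2 * (r * u ^ 2) + 1 / 2 * (r * v ^ 2) + 2 * w + γ * r ^ 2 + K ^ 2 * r := by
  have hrt : rt = -(rx * u + r * ux) := by linarith
  have hmat : r * (ut + u * ux) = μ * uxx - (p + γ * r) * rx + γ * r * cx := by
    rw [hrt] at hmom
    linear_combination hmom
  have heff : r * (vt + u * vx) = -(p + γ * r) * rx + γ * r * cx := by
    have h1 : r * (vt + u * vx) = r * (ut + u * ux) - μ * uxx := by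
      rw [hvt, hvx, hrt]
      field_simp
      ring
    linear_combination h1 + hmat
  have hdiss : 0 ≤ (p + γ * r) * (rx * (v - u)) := by
    refine mul_nonneg hp ?_
    have : rx * (v - u) = μ * rx ^ 2 / r ^ 2 := by
      rw [hv]
      ring
    rw [this]
    positivity
  have hK2 : (γ * cx) ^ 2 ≤ K ^ 2 := sq_le_sq.2 (hK.trans (le_abs_self K))
  have hforce : r * (γ * cx * (u + v)) ≤ r * (1 / 2 * u ^ 2 + 1 / 2 * v ^ 2 + K ^ 2) := by
    refine mul_le_mul_of_nonneg_left ?_ hr.le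
    nlinarith [sq_nonneg (γ * cx - u), sq_nonneg (γ * cx - v)]
  have hux : 0 ≤ μ * ux ^ 2 := by positivity
  have hr2 : 0 ≤ γ * r ^ 2 := by positivity
  have hid : (1 / 2 * (rt * u ^ 2 + r * (2 * u * ut)) + 1 / 2 * (rt * v ^ 2 + r * (2 * v * vt))
        + 2 * (w1 * rt) + γ * (2 * r * rt) + K ^ 2 * rt)
      + (1 / 2 * ((rx * u + r * ux) * u ^ 2 + r * u * (2 * u * ux))
        + 1 / 2 * ((rx * u + r * ux) * v ^ 2 + r * u * (2 * v * vx))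
        + ((2 * (w2 * rx) + 2 * γ * rx) * (r * u)
          + (2 * w1 + 2 * γ * r + K ^ 2) * (rx * u + r * ux))
        - μ * (ux * ux + u * uxx))
      = r * (γ * cx * (u + v)) - (p + γ * r) * (rx * (v - u)) - μ * ux ^ 2 := by
    linear_combination (1 / 2 * u ^ 2 + 1 / 2 * v ^ 2 + 2 * w1 + 2 * γ * r + K ^ 2) * hmass
      + u * hmat + v * heff + 2 * rx * u * hw2
  rw [hid]
  linarith

section Solution

variable {μ κ γ T : ℝ} {P : ℝ → ℝ} {ρ u c : ℝ → ℝ → ℝ} {ρ₀ u₀ : ℝ → ℝ}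

theorem IsNSKSolution.hasDerivAt_deriv_rho (h : IsNSKSolution μ κ γ P (Ico 0 T) ρ u c ρ₀ u₀)
    {t : ℝ} (ht : t ∈ Ioo 0 T) (x : ℝ) :
    HasDerivAt (fun s => deriv (ρ s) x)
      (-(deriv (deriv (ρ t)) x * u t x + 2 * (deriv (ρ t) x * deriv (u t) x)
        + ρ t x * deriv (deriv (u t)) x)) t := by
  have htI : t ∈ Ico 0 T := Ioo_subset_Ico_self ht
  have hρ : ContDiff ℝ ∞ (ρ t) := slice_contDiff h.smooth_rho htI
  have hu : ContDiff ℝ ∞ (u t) := slice_contDiff h.smooth_u htI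
  have hρd : ∀ y, HasDerivAt (ρ t) (deriv (ρ t) y) y := fun y =>
    (hρ.differentiable (by simp) y).hasDerivAt
  have hud : ∀ y, HasDerivAt (u t) (deriv (u t) y) y := fun y =>
    (hu.differentiable (by simp) y).hasDerivAt
  have hρdd := ((contDiff_infty_iff_deriv.1 hρ).2.differentiable (by simp) x).hasDerivAt
  have hudd := ((contDiff_infty_iff_deriv.1 hu).2.differentiable (by simp) x).hasDerivAt
  have hfun : (fun y => deriv (fun s => ρ s y) t)
      = fun y => -(deriv (ρ t) y * u t y + ρ t y * deriv (u t) y) := by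
    funext y
    have h1 := h.mass t htI y
    have h2 : deriv (fun y => ρ t y * u t y) y = _ := ((hρd y).mul (hud y)).deriv
    rw [h2] at h1
    linarith
  have hmix := hasDerivAt_deriv_snd
    (h.smooth_rho.mono (prod_mono Ioo_subset_Ico_self subset_rfl)) ht x
  rw [hfun] at hmix
  refine hmix.congr_deriv ?_
  refine ((hρdd.mul (hud x)).add ((hρd x).mul hudd)).neg.deriv.trans ?_
  ring

theorem IsNSKSolution.contDiffOn_effectiveVelocity
    (h : IsNSKSolution μ κ γ P (Ico 0 T) ρ u c ρ₀ u₀) :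
    ContDiffOn ℝ ∞ (fun p : ℝ × ℝ => effectiveVelocity μ ρ u p.1 p.2)
      (Ico 0 T ×ˢ (univ : Set ℝ)) :=
  h.smooth_u.add ((contDiffOn_const.mul (contDiffOn_deriv_snd h.smooth_rho)).div
    (h.smooth_rho.pow 2) fun p _ => (pow_pos (h.rho_pos p.1 p.2) 2).ne')

theorem IsNSKSolution.contDiffOn_bdEnergy (h : IsNSKSolution μ κ γ P (Ico 0 T) ρ u c ρ₀ u₀)
    {W : ℝ → ℝ} (hW : IsPressurePotential P W) (K : ℝ) :
    ContDiffOn ℝ 1 (fun p : ℝ × ℝ => bdEnergy μ γ K W ρ u p.1 p.2)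
      (Ico 0 T ×ˢ (univ : Set ℝ)) := by
  have hρ := h.smooth_rho.of_le (m := 1) (by simp)
  have hu := h.smooth_u.of_le (m := 1) (by simp)
  have hv := h.contDiffOn_effectiveVelocity.of_le (m := 1) (by simp)
  have hWρ : ContDiffOn ℝ 1 (fun p : ℝ × ℝ => W (ρ p.1 p.2)) (Ico 0 T ×ˢ (univ : Set ℝ)) :=
    (hW.smooth.of_le (by norm_num)).comp hρ fun p _ => h.rho_pos p.1 p.2
  exact ((((contDiffOn_const.mul (hρ.mul (hu.pow 2))).add
    (contDiffOn_const.mul (hρ.mul (hv.pow 2)))).add (contDiffOn_const.mul hWρ)).add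
    (contDiffOn_const.mul (hρ.pow 2))).add (contDiffOn_const.mul hρ)

theorem IsPressurePotential.contDiffOn_deriv {W : ℝ → ℝ} (hW : IsPressurePotential P W) :
    ContDiffOn ℝ 1 (deriv W) (Ioi 0) :=
  hW.smooth.deriv_of_isOpen isOpen_Ioi (by norm_num)

theorem IsNSKSolution.contDiff_bdFlux (h : IsNSKSolution μ κ γ P (Ico 0 T) ρ u c ρ₀ u₀)
    {W : ℝ → ℝ} (hW : IsPressurePotential P W) (K : ℝ) {t : ℝ} (ht : t ∈ Ico 0 T) :
    ContDiff ℝ 1 (bdFlux μ γ K W ρ u t) := by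
  have hρ := (slice_contDiff h.smooth_rho ht).of_le (m := 1) (by simp)
  have hu := (slice_contDiff h.smooth_u ht).of_le (m := 1) (by simp)
  have hux := (slice_contDiff (F := fun t => deriv (u t))
    (contDiffOn_deriv_snd h.smooth_u) ht).of_le (m := 1) (by simp)
  have hv := (slice_contDiff h.contDiffOn_effectiveVelocity ht).of_le (m := 1) (by simp)
  have hWρ : ContDiff ℝ 1 fun x => deriv W (ρ t x) :=
    hW.contDiffOn_deriv.comp_contDiff hρ fun x => h.rho_pos t x
  exact (((contDiff_const.mul ((hρ.mul hu).mul (hu.pow 2))).add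
    (contDiff_const.mul ((hρ.mul hu).mul (hv.pow 2)))).add
    ((((contDiff_const.mul hWρ).add (contDiff_const.mul hρ)).add contDiff_const).mul
      (hρ.mul hu))).sub (contDiff_const.mul (hu.mul hux))

theorem IsNSKSolution.periodic_deriv_rho (h : IsNSKSolution μ κ γ P (Ico 0 T) ρ u c ρ₀ u₀)
    (t x : ℝ) : deriv (ρ t) (x + 1) = deriv (ρ t) x := by
  rw [← deriv_comp_add_const, show (fun y => ρ t (y + 1)) = ρ t from funext (h.periodic_rho t)]

theorem IsNSKSolution.periodic_deriv_u (h : IsNSKSolution μ κ γ P (Ico 0 T) ρ u c ρ₀ u₀)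
    (t x : ℝ) : deriv (u t) (x + 1) = deriv (u t) x := by
  rw [← deriv_comp_add_const, show (fun y => u t (y + 1)) = u t from funext (h.periodic_u t)]

theorem IsNSKSolution.bdFlux_one (h : IsNSKSolution μ κ γ P (Ico 0 T) ρ u c ρ₀ u₀)
    (W : ℝ → ℝ) (K t : ℝ) : bdFlux μ γ K W ρ u t 1 = bdFlux μ γ K W ρ u t 0 := by
  have h1 := h.periodic_rho t 0
  have h2 := h.periodic_u t 0
  have h3 := h.periodic_deriv_rho t 0
  have h4 := h.periodic_deriv_u t 0
  rw [zero_add] at h1 h2 h3 h4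
  simp only [bdFlux, effectiveVelocity, h1, h2, h3, h4]

theorem IsNSKSolution.bdEnergy_flux_le (h : IsNSKSolution μ κ γ P (Ico 0 T) ρ u c ρ₀ u₀)
    (hμ : 0 < μ) {β a : ℝ} (hP : IsAdmissiblePair P γ β a) {W : ℝ → ℝ}
    (hW : IsPressurePotential P W) {K t x : ℝ} (ht : t ∈ Ioo 0 T)
    (hK : |γ * deriv (c t) x| ≤ K) :
    deriv (fun s => bdEnergy μ γ K W ρ u s x) t + deriv (bdFlux μ γ K W ρ u t) x
      ≤ bdEnergy μ γ K W ρ u t x := by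
  have htI : t ∈ Ico 0 T := Ioo_subset_Ico_self ht
  have hmem : Ico 0 T ×ˢ (univ : Set ℝ) ∈ 𝓝 (t, x) :=
    prod_mem_nhds (Ico_mem_nhds ht.1 ht.2) univ_mem
  have hr : 0 < ρ t x := h.rho_pos t x
  have hρ := slice_contDiff h.smooth_rho htI
  have hu := slice_contDiff h.smooth_u htI
  have hρt : HasDerivAt (fun s => ρ s x) (deriv (fun s => ρ s x) t) t :=
    (hasDerivAt_fst ((h.smooth_rho.contDiffAt hmem).differentiableAt
      (by simp))).differentiableAt.hasDerivAt
  have hut : HasDerivAt (fun s => u s x) (deriv (fun s => u s x) t) t :=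
    (hasDerivAt_fst ((h.smooth_u.contDiffAt hmem).differentiableAt
      (by simp))).differentiableAt.hasDerivAt
  have hρx : HasDerivAt (ρ t) (deriv (ρ t) x) x := (hρ.differentiable (by simp) x).hasDerivAt
  have hux : HasDerivAt (u t) (deriv (u t) x) x := (hu.differentiable (by simp) x).hasDerivAt
  have hcx : HasDerivAt (c t) (deriv (c t) x) x :=
    ((slice_contDiff h.smooth_c htI).differentiable (by simp) x).hasDerivAt
  have hρxx := ((contDiff_infty_iff_deriv.1 hρ).2.differentiable (by simp) x).hasDerivAt
  have huxx := ((contDiff_infty_iff_deriv.1 hu).2.differentiable (by simp) x).hasDerivAt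
  have hρxt := h.hasDerivAt_deriv_rho ht x
  obtain ⟨hPd, hPn⟩ := hP.deriv_nonneg hr
  have hWd : HasDerivAt W (deriv W (ρ t x)) (ρ t x) :=
    ((hW.smooth.contDiffAt (Ioi_mem_nhds hr)).differentiableAt (by simp)).hasDerivAt
  have hWdd : HasDerivAt (deriv W) (deriv (deriv W) (ρ t x)) (ρ t x) :=
    ((hW.contDiffOn_deriv.contDiffAt (Ioi_mem_nhds hr)).differentiableAt
      (by simp)).hasDerivAt
  have hvt : HasDerivAt (fun s => effectiveVelocity μ ρ u s x) _ t :=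
    (hut.add ((hρxt.const_mul μ).div (hρt.pow 2) (pow_pos hr 2).ne')).congr_deriv
      (show _ = deriv (fun s => u s x) t
        + μ * (-(deriv (deriv (ρ t)) x * u t x + 2 * (deriv (ρ t) x * deriv (u t) x)
          + ρ t x * deriv (deriv (u t)) x) / ρ t x ^ 2
          - 2 * deriv (ρ t) x * deriv (fun s => ρ s x) t / ρ t x ^ 3) by
        simp only [Pi.pow_apply]
        field_simp
        norm_num
        ring)
  have hvx : HasDerivAt (effectiveVelocity μ ρ u t) _ x :=
    (hux.add ((hρxx.const_mul μ).div (hρx.pow 2) (pow_pos hr 2).ne')).congr_deriv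
      (show _ = deriv (u t) x + μ * (deriv (deriv (ρ t)) x / ρ t x ^ 2
          - 2 * deriv (ρ t) x * deriv (ρ t) x / ρ t x ^ 3) by
        simp only [Pi.pow_apply]
        field_simp
        norm_num
        ring)
  have hmass := h.mass t htI x
  have hmom := h.momentum t htI x
  have e1 : deriv (fun y => ρ t y * u t y) x = _ := (hρx.mul hux).deriv
  have e2 : deriv (fun s => ρ s x * u s x) t = _ := (hρt.mul hut).deriv
  have e3 : deriv (fun y => ρ t y * u t y ^ 2) x = _ := (hρx.mul (hux.pow 2)).deriv
  have e4 : deriv (fun y => P (ρ t y)) x = _ := (hPd.hasDerivAt.comp x hρx).deriv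
  have e5 : deriv (fun y => c t y - ρ t y) x = _ := (hcx.sub hρx).deriv
  rw [e1] at hmass
  rw [e2, e3, e4, e5] at hmom
  have het := ((((hρt.mul (hut.pow 2)).const_mul (1 / 2)).add
    ((hρt.mul (hvt.pow 2)).const_mul (1 / 2))).add ((hWd.comp t hρt).const_mul 2)).add
    ((hρt.pow 2).const_mul γ) |>.add (hρt.const_mul (K ^ 2))
  have hqx := ((((hρx.mul hux).mul (hux.pow 2)).const_mul (1 / 2)).add
    (((hρx.mul hux).mul (hvx.pow 2)).const_mul (1 / 2))).add
    (((((hWdd.comp x hρx).const_mul 2).add (hρx.const_mul (2 * γ))).add_const (K ^ 2)).mul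
      (hρx.mul hux)) |>.sub ((hux.mul huxx).const_mul μ)
  have e6 : deriv (fun s => bdEnergy μ γ K W ρ u s x) t = _ := het.deriv
  have e7 : deriv (bdFlux μ γ K W ρ u t) x = _ := hqx.deriv
  rw [e6, e7]
  have hmain := bdEnergy_algebra (rxx := deriv (deriv (ρ t)) x) (uxx := deriv (deriv (u t)) x)
    (ut := deriv (fun s => u s x) t) (v := effectiveVelocity μ ρ u t x) (w1 := deriv W (ρ t x))
    hμ hr (hW.nonneg _ hr.le) hP.gamma_pos hPn hK (hW.relation _ hr) rfl rfl rfl hmass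
    (by simpa using hmom)
  refine le_trans (le_of_eq ?_) hmain
  simp only [Pi.pow_apply, Pi.mul_apply, Pi.add_apply, Function.comp_apply, Nat.cast_ofNat,
    Nat.add_one_sub_one, pow_one]

end Solution

theorem bdEnergy_bound_algebra {μ γ K M r rx u v w Wm : ℝ} (hγ : 0 < γ)
    (hM : 0 < M) (hr1 : M⁻¹ ≤ r) (hr2 : r ≤ M) (hv : v = u + μ * rx / r ^ 2) (hw : w ≤ Wm) :
    1 / 2 * (r * u ^ 2) + 1 / 2 * (r * v ^ 2) + 2 * w + γ * r ^ 2 + K ^ 2 * r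
      ≤ 3 / 2 * M * u ^ 2 + μ ^ 2 * M ^ 3 * rx ^ 2 + (2 * Wm + γ * M ^ 2 + K ^ 2 * M) := by
  have hr : 0 < r := (inv_pos.2 hM).trans_le hr1
  have h1 : r * v ^ 2 ≤ 2 * (r * u ^ 2) + 2 * (μ ^ 2 * rx ^ 2 * r⁻¹ ^ 3) := by
    have h2 : r * (μ * rx / r ^ 2) ^ 2 = μ ^ 2 * rx ^ 2 * r⁻¹ ^ 3 := by
      field_simp
    have h3 : 0 ≤ r * (u - μ * rx / r ^ 2) ^ 2 := by positivity
    rw [← h2, hv]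
    linear_combination h3
  have h4 : r * u ^ 2 ≤ M * u ^ 2 := by gcongr
  have h5 : μ ^ 2 * rx ^ 2 * r⁻¹ ^ 3 ≤ μ ^ 2 * rx ^ 2 * M ^ 3 := by
    have : r⁻¹ ≤ M := inv_le_of_inv_le₀ hM hr1
    gcongr
  have h6 : γ * r ^ 2 ≤ γ * M ^ 2 := by gcongr
  have h7 : K ^ 2 * r ≤ K ^ 2 * M := by gcongr
  linarith

theorem abs_logDeriv_le_algebra {μ γ K r rx u v w : ℝ} (hμ : 0 < μ) (hγ : 0 < γ) (hr : 0 < r)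
    (hw : 0 ≤ w) (hv : v = u + μ * rx / r ^ 2) :
    |rx / r| ≤ 2 / μ ^ 2 * (1 / 2 * (r * u ^ 2) + 1 / 2 * (r * v ^ 2) + 2 * w + γ * r ^ 2
      + K ^ 2 * r) + 1 / 2 * r := by
  have h1 : |rx / r| ≤ 1 / (2 * μ ^ 2) * (r * (v - u) ^ 2) + 1 / 2 * r := by
    have h2 : 1 / (2 * μ ^ 2) * (r * (v - u) ^ 2) = 1 / 2 * (|rx / r| ^ 2 / r) := by
      rw [hv, sq_abs]
      field_simp
      ring
    have h3 : 0 ≤ 1 / 2 * ((|rx / r| - r) ^ 2 / r) := by positivity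
    have h4 : 1 / 2 * ((|rx / r| - r) ^ 2 / r)
        = 1 / 2 * (|rx / r| ^ 2 / r) - |rx / r| + 1 / 2 * r := by
      field_simp
      ring
    rw [h2]
    linarith
  have h5 : r * (v - u) ^ 2 ≤ 4 * (1 / 2 * (r * u ^ 2) + 1 / 2 * (r * v ^ 2) + 2 * w + γ * r ^ 2
      + K ^ 2 * r) := by
    have h6 : 0 ≤ r * (v + u) ^ 2 := by positivity
    have h7 : 0 ≤ γ * r ^ 2 := by positivity
    have h8 : 0 ≤ K ^ 2 * r := by positivity
    linarith
  calc |rx / r| ≤ 1 / (2 * μ ^ 2) * (r * (v - u) ^ 2) + 1 / 2 * r := h1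
    _ ≤ 1 / (2 * μ ^ 2) * (4 * (1 / 2 * (r * u ^ 2) + 1 / 2 * (r * v ^ 2) + 2 * w + γ * r ^ 2
      + K ^ 2 * r)) + 1 / 2 * r := by gcongr
    _ = _ := by
      field_simp
      ring

theorem integral_sq_add_deriv_sq {f : ℝ → ℝ} :
    ∫ x in (0:ℝ)..1, (f x ^ 2 + deriv f x ^ 2) = H1norm f ^ 2 :=
  (Real.sq_sqrt (intervalIntegral.integral_nonneg zero_le_one fun x _ => by positivity)).symm

/-- Bound for the initial value of the integral of `bdEnergy`. -/
noncomputable def initialBound (A B M μ γ K : ℝ) (W : ℝ → ℝ) : ℝ :=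
  3 / 2 * M * B ^ 2 + μ ^ 2 * M ^ 3 * A ^ 2
    + (2 * sSup (W '' Icc M⁻¹ M) + γ * M ^ 2 + K ^ 2 * M)

/-- Bound for the integral of the logarithmic derivative of the density. -/
noncomputable def logDerivBound (A B M μ κ γ : ℝ) (W : ℝ → ℝ) (T : ℝ) : ℝ :=
  2 / μ ^ 2 * (Real.exp T * initialBound A B M μ γ (γ * (γ / κ * M)) W) + 1 / 2 * M

section Bounds

variable {μ κ γ T : ℝ} {P : ℝ → ℝ} {ρ u c : ℝ → ℝ → ℝ} {ρ₀ u₀ : ℝ → ℝ}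

theorem IsNSKSolution.integral_rho_eq (h : IsNSKSolution μ κ γ P (Ico 0 T) ρ u c ρ₀ u₀)
    {t : ℝ} (ht : t ∈ Ico 0 T) :
    ∫ x in (0:ℝ)..1, ρ t x = ∫ x in (0:ℝ)..1, ρ₀ x := by
  have hsub : Ioo 0 T ×ˢ (univ : Set ℝ) ⊆ Ico 0 T ×ˢ (univ : Set ℝ) :=
    prod_mono Ioo_subset_Ico_self subset_rfl
  have hq : ∀ t ∈ Ioo 0 T, ContDiff ℝ 1 fun y => ρ t y * u t y := fun t ht =>
    ((slice_contDiff h.smooth_rho (Ioo_subset_Ico_self ht)).mul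
      (slice_contDiff h.smooth_u (Ioo_subset_Ico_self ht))).of_le (by simp)
  have hper : ∀ t, ρ t 1 * u t 1 = ρ t 0 * u t 0 := fun t => by
    have h1 := h.periodic_rho t 0
    have h2 := h.periodic_u t 0
    rw [zero_add] at h1 h2
    rw [h1, h2]
  have hinit : ρ 0 = ρ₀ := funext h.init_rho
  have hup := integral_le_exp_mul_of_flux (k := 0) (q := fun t y => ρ t y * u t y)
    h.smooth_rho.continuousOn ((h.smooth_rho.mono hsub).of_le (by simp)) hq hper
    (fun t ht x => by rw [h.mass t (Ioo_subset_Ico_self ht) x, zero_mul]) ht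
  have hlow := integral_le_exp_mul_of_flux (k := 0) (e := fun t y => -ρ t y)
    (q := fun t y => -(ρ t y * u t y))
    h.smooth_rho.continuousOn.neg ((h.smooth_rho.mono hsub).of_le (by simp)).neg
    (fun t ht => (hq t ht).neg) (fun t => by simp only [hper])
    (fun t ht x => by
      have := h.mass t (Ioo_subset_Ico_self ht) x
      rw [deriv.fun_neg, deriv.fun_neg]
      linarith) ht
  simp only [zero_mul, Real.exp_zero, one_mul, intervalIntegral.integral_neg, hinit] at hup hlow
  linarith

theorem IsNSKSolution.integral_bdEnergy_zero_le
    (h : IsNSKSolution μ κ γ P (Ico 0 T) ρ u c ρ₀ u₀) (hγ : 0 < γ) (hT : 0 < T)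
    {W : ℝ → ℝ} (hW : IsPressurePotential P W) {M : ℝ} (hM : 0 < M)
    (hρ₀ : ∀ x, M⁻¹ ≤ ρ₀ x ∧ ρ₀ x ≤ M) (K : ℝ) :
    ∫ x in (0:ℝ)..1, bdEnergy μ γ K W ρ u 0 x
      ≤ initialBound (H1norm ρ₀) (H1norm u₀) M μ γ K W := by
  have h0 : (0:ℝ) ∈ Ico 0 T := ⟨le_rfl, hT⟩
  have hρe : ρ 0 = ρ₀ := funext h.init_rho
  have hue : u 0 = u₀ := funext h.init_u
  have hρ : ContDiff ℝ ∞ ρ₀ := hρe ▸ slice_contDiff h.smooth_rho h0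
  have hu : ContDiff ℝ ∞ u₀ := hue ▸ slice_contDiff h.smooth_u h0
  have hρc := hρ.continuous
  have huc := hu.continuous
  have hρx : Continuous (deriv ρ₀) := hρ.continuous_deriv (by simp)
  have hux : Continuous (deriv u₀) := hu.continuous_deriv (by simp)
  have hbdd : BddAbove (W '' Icc M⁻¹ M) := isCompact_Icc.bddAbove_image
    (hW.smooth.continuousOn.mono fun r hr => (inv_pos.2 hM).trans_le hr.1)
  set D := 2 * sSup (W '' Icc M⁻¹ M) + γ * M ^ 2 + K ^ 2 * M with hD
  have hcont : Continuous fun x => 3 / 2 * M * (u₀ x ^ 2 + deriv u₀ x ^ 2)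
      + μ ^ 2 * M ^ 3 * (ρ₀ x ^ 2 + deriv ρ₀ x ^ 2) + D := by fun_prop
  calc ∫ x in (0:ℝ)..1, bdEnergy μ γ K W ρ u 0 x
      ≤ ∫ x in (0:ℝ)..1, (3 / 2 * M * (u₀ x ^ 2 + deriv u₀ x ^ 2)
        + μ ^ 2 * M ^ 3 * (ρ₀ x ^ 2 + deriv ρ₀ x ^ 2) + D) := by
        refine intervalIntegral.integral_mono_on zero_le_one
          ((slice_contDiff (h.contDiffOn_bdEnergy hW K) h0).continuous.intervalIntegrable _ _)
          (hcont.intervalIntegrable _ _) fun x _ => ?_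
        have h1 := bdEnergy_bound_algebra (μ := μ) (K := K) (u := u₀ x) (rx := deriv ρ₀ x) hγ hM
          (hρ₀ x).1 (hρ₀ x).2 rfl
          (le_csSup hbdd (mem_image_of_mem W ⟨(hρ₀ x).1, (hρ₀ x).2⟩))
        have h2 : 0 ≤ 3 / 2 * M * deriv u₀ x ^ 2 := by positivity
        have h3 : 0 ≤ μ ^ 2 * M ^ 3 * ρ₀ x ^ 2 := by positivity
        simp only [bdEnergy, effectiveVelocity, hρe, hue]
        linarith
    _ = initialBound (H1norm ρ₀) (H1norm u₀) M μ γ K W := by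
        rw [intervalIntegral.integral_add, intervalIntegral.integral_add,
          intervalIntegral.integral_const_mul, intervalIntegral.integral_const_mul,
          integral_sq_add_deriv_sq, integral_sq_add_deriv_sq]
        · simp [initialBound, hD]
        all_goals exact (by fun_prop : Continuous _).intervalIntegrable _ _

theorem IsNSKSolution.integral_logDeriv_le
    (h : IsNSKSolution μ κ γ P (Ico 0 T) ρ u c ρ₀ u₀) (hμ : 0 < μ) (hκ : 0 < κ) (hγ : 0 < γ)
    (hT : 0 < T) {β a : ℝ} (hP : IsAdmissiblePair P γ β a)
    {W : ℝ → ℝ} (hW : IsPressurePotential P W) {M : ℝ} (hM : 0 < M)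
    (hρ₀ : ∀ x, M⁻¹ ≤ ρ₀ x ∧ ρ₀ x ≤ M) (hmass : ∫ x in (0:ℝ)..1, ρ₀ x ≤ M)
    {t : ℝ} (ht : t ∈ Ico 0 T) :
    ∫ x in (0:ℝ)..1, |deriv (ρ t) x / ρ t x|
      ≤ logDerivBound (H1norm ρ₀) (H1norm u₀) M μ κ γ W T := by
  set K := γ * (γ / κ * M) with hKdef
  have hcx : ∀ s ∈ Ioo 0 T, ∀ x, |γ * deriv (c s) x| ≤ K := by
    intro s hs x
    have hsI := Ioo_subset_Ico_self hs
    have h1 := abs_deriv_le_of_screened_poisson hκ hγ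
      ((slice_contDiff h.smooth_c hsI).of_le (m := 2) (WithTop.coe_le_coe.2 le_top))
      (slice_contDiff h.smooth_rho hsI).continuous (h.periodic_c s) (h.periodic_rho s)
      (h.rho_pos s) (h.elliptic s hsI) x
    rw [h.integral_rho_eq hsI] at h1
    rw [abs_mul, abs_of_pos hγ]
    have : γ / κ * ∫ x in (0:ℝ)..1, ρ₀ x ≤ γ / κ * M := by gcongr
    exact mul_le_mul_of_nonneg_left (h1.trans this) hγ.le
  have hC1 := h.contDiffOn_bdEnergy hW K
  have hE := integral_le_exp_mul_of_flux (k := 1) hC1.continuousOn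
    (hC1.mono (prod_mono Ioo_subset_Ico_self subset_rfl))
    (fun s hs => h.contDiff_bdFlux hW K (Ioo_subset_Ico_self hs)) (h.bdFlux_one W K)
    (fun s hs x => by
      rw [one_mul]
      exact h.bdEnergy_flux_le hμ hP hW hs (hcx s hs x)) ht
  have hI0 := h.integral_bdEnergy_zero_le hγ hT hW hM hρ₀ K
  have hI0pos : 0 ≤ ∫ x in (0:ℝ)..1, bdEnergy μ γ K W ρ u 0 x := by
    refine intervalIntegral.integral_nonneg zero_le_one fun x _ => ?_
    have h1 := h.rho_pos 0 x
    have h2 := hW.nonneg _ h1.le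
    unfold bdEnergy
    positivity
  have hEt : ∫ x in (0:ℝ)..1, bdEnergy μ γ K W ρ u t x
      ≤ Real.exp T * initialBound (H1norm ρ₀) (H1norm u₀) M μ γ K W := by
    refine hE.trans (mul_le_mul ?_ hI0 hI0pos (Real.exp_pos _).le)
    rw [one_mul]
    exact Real.exp_le_exp.2 ht.2.le
  have hρ := slice_contDiff h.smooth_rho ht
  have hρc : Continuous (ρ t) := hρ.continuous
  have hquot : Continuous fun x => |deriv (ρ t) x / ρ t x| :=
    ((hρ.continuous_deriv (by simp)).div hρc fun x => (h.rho_pos t x).ne').abs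
  have hec : Continuous (bdEnergy μ γ K W ρ u t) := (slice_contDiff hC1 ht).continuous
  calc ∫ x in (0:ℝ)..1, |deriv (ρ t) x / ρ t x|
      ≤ ∫ x in (0:ℝ)..1, (2 / μ ^ 2 * bdEnergy μ γ K W ρ u t x + 1 / 2 * ρ t x) :=
        intervalIntegral.integral_mono_on zero_le_one (hquot.intervalIntegrable _ _)
          (((hec.const_mul _).add (hρc.const_mul _)).intervalIntegrable _ _) fun x _ =>
            abs_logDeriv_le_algebra hμ hγ (h.rho_pos t x) (hW.nonneg _ (h.rho_pos t x).le) rfl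
    _ = 2 / μ ^ 2 * (∫ x in (0:ℝ)..1, bdEnergy μ γ K W ρ u t x)
        + 1 / 2 * ∫ x in (0:ℝ)..1, ρ₀ x := by
        rw [intervalIntegral.integral_add ((hec.const_mul _).intervalIntegrable _ _)
          ((hρc.const_mul _).intervalIntegrable _ _), intervalIntegral.integral_const_mul,
          intervalIntegral.integral_const_mul, h.integral_rho_eq ht]
    _ ≤ logDerivBound (H1norm ρ₀) (H1norm u₀) M μ κ γ W T := by
        unfold logDerivBound
        gcongr

end Bounds

/-- Uniform-in-time `L^∞` bounds for the density: there is `C(T₀) > 0`, depending only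
on `‖ρ₀‖_{H¹}`, `‖u₀‖_{H¹}`, `M₀`, `μ`, `κ`, `γ`, `W` and `T₀`, such that
`C(T₀)⁻¹ ≤ ρ(t,x) ≤ C(T₀)` on `[0,T₀) × ℝ`. -/
theorem density_Linfty_bounds :
    ∃ C : ℝ → ℝ → ℝ → ℝ → ℝ → ℝ → (ℝ → ℝ) → ℝ → ℝ,
      ∀ (μ κ γ M₀ T₀ β a : ℝ) (P W : ℝ → ℝ) (ρ u c : ℝ → ℝ → ℝ) (ρ₀ u₀ : ℝ → ℝ),
        0 < μ → 0 < κ → 0 < γ → 0 < M₀ → 0 < T₀ →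
        IsAdmissiblePair P γ β a → IsPressurePotential P W →
        IsNSKSolution μ κ γ P (Set.Ico 0 T₀) ρ u c ρ₀ u₀ →
        (∀ x : ℝ, M₀⁻¹ ≤ ρ₀ x ∧ ρ₀ x ≤ M₀) →
        0 < C (H1norm ρ₀) (H1norm u₀) M₀ μ κ γ W T₀ ∧
        ∀ t ∈ Set.Ico 0 T₀, ∀ x : ℝ,
          (C (H1norm ρ₀) (H1norm u₀) M₀ μ κ γ W T₀)⁻¹ ≤ ρ t x ∧
            ρ t x ≤ C (H1norm ρ₀) (H1norm u₀) M₀ μ κ γ W T₀ := by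
  refine ⟨fun A B M μ κ γ W T => M * Real.exp (logDerivBound A B M μ κ γ W T), ?_⟩
  intro μ κ γ M T β a P W ρ u c ρ₀ u₀ hμ hκ hγ hM hT hP hW h hρ₀
  refine ⟨by positivity, fun t ht x => ?_⟩
  have hint : IntervalIntegrable ρ₀ volume 0 1 := by
    rw [← funext h.init_rho]
    exact (slice_contDiff h.smooth_rho ⟨le_rfl, hT⟩).continuous.intervalIntegrable _ _
  have hmass1 : M⁻¹ ≤ ∫ x in (0:ℝ)..1, ρ₀ x := by
    simpa using intervalIntegral.integral_mono_on zero_le_one intervalIntegrable_const hint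
      fun x _ => (hρ₀ x).1
  have hmass2 : ∫ x in (0:ℝ)..1, ρ₀ x ≤ M := by
    simpa using intervalIntegral.integral_mono_on zero_le_one hint intervalIntegrable_const
      fun x _ => (hρ₀ x).2
  have hL := h.integral_logDeriv_le hμ hκ hγ hT hP hW hM hρ₀ hmass2 ht
  set L := logDerivBound (H1norm ρ₀) (H1norm u₀) M μ κ γ W T
  obtain ⟨y, hy, hxy⟩ := Function.Periodic.exists_mem_Ico₀ (h.periodic_rho t) one_pos x
  obtain ⟨h1, h2⟩ := mean_bounds_of_integral_logDeriv
    ((slice_contDiff h.smooth_rho ht).of_le (by simp)) (h.rho_pos t) hL (Ico_subset_Icc_self hy)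
  rw [h.integral_rho_eq ht] at h1 h2
  rw [hxy]
  constructor
  · rw [mul_inv, ← div_eq_mul_inv, div_le_iff₀ (Real.exp_pos L), mul_comm]
    exact hmass1.trans h1
  · exact (h2.trans (mul_le_mul_of_nonneg_left hmass2 (Real.exp_pos L).le)).trans_eq
      (mul_comm _ _)
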